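/- arXiv:2505.10068 — 2 statements merged into one kernel-verified Lean document; each statement's English description precedes it below -/
import Mathlib

section
/- Let q = 2^r be a power of 2, m ≥ 1, N_j > 1 with N_j − 1 dividing q − 1 for j = 1,…,m, and J ⊆ {1,…,m}. Let Δ_1, Δ_2 ⊆ E_J be unions of complete cyclotomic sets with respect to F_2. If (1) Δ_2 ⊆ Δ_1, and (2) for every a ∈ \overline{Δ_1 + Δ_1 + Δ_2} there exists j ∈ {1,…,m} such that either (j ∈ J and a_j ≠ 0) or (j ∉ J and a_j ≠ N_j − 1), then the pair of binary subfield subcodes (S(C^J_{Δ_1}), S(C^J_{Δ_2})) is a CSS-T pair. -/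
attribute [local instance] Classical.propDecidable

open scoped Pointwise

noncomputable section

/-- The evaluation point set `Z = Z₁ × ⋯ × Z_m` of a `J`-affine variety code:
for `j ∈ J`, `Z_j` is the set of roots of `X^(N_j - 1) - 1`; for `j ∉ J`,
`Z_j` is the set of roots of `X^(N_j) - X`. -/
def ZJ (F : Type) [Field F] (m : ℕ) (N : Fin m → ℕ) (J : Set (Fin m)) : Set (Fin m → F) :=
  {P | ∀ j, if j ∈ J then P j ^ (N j - 1) = 1 else P j ^ (N j) = P j}

instance (F : Type) [Field F] [Finite F] (m : ℕ) (N : Fin m → ℕ) (J : Set (Fin m)) :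
    Finite (ZJ F m N J) := Subtype.finite

noncomputable instance (F : Type) [Field F] [Finite F] (m : ℕ) (N : Fin m → ℕ)
    (J : Set (Fin m)) : Fintype (ZJ F m N J) := Fintype.ofFinite _

/-- Evaluation of the monomial `X^a` at the points of `Z`. -/
def evJ (F : Type) [Field F] (m : ℕ) (N : Fin m → ℕ) (J : Set (Fin m))
    (a : Fin m → ℕ) : ZJ F m N J → F :=
  fun P => ∏ j, (P : Fin m → F) j ^ a j

/-- The `J`-affine variety code `C^J_Δ`. -/
def CJ (F : Type) [Field F] (m : ℕ) (N : Fin m → ℕ) (J : Set (Fin m))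
    (Δ : Set (Fin m → ℕ)) : Submodule F (ZJ F m N J → F) :=
  Submodule.span F (evJ F m N J '' Δ)

/-- The exponent set `E_J = {0,…,T₁} × ⋯ × {0,…,T_m}`, where `T_j = N_j - 2`
for `j ∈ J` and `T_j = N_j - 1` otherwise. -/
def EJ (m : ℕ) (N : Fin m → ℕ) (J : Set (Fin m)) : Set (Fin m → ℕ) :=
  {a | ∀ j, a j ≤ (if j ∈ J then N j - 2 else N j - 1)}

/-- The reduction `a ↦ ā` of an exponent vector into `E_J`: for `j ∈ J` reduce
modulo `N_j - 1` into `{0,…,N_j-2}`; for `j ∉ J`, `0 ↦ 0` and otherwise reduce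
modulo `N_j - 1` into `{1,…,N_j-1}`. -/
def barJ (m : ℕ) (N : Fin m → ℕ) (J : Set (Fin m)) (a : Fin m → ℕ) : Fin m → ℕ :=
  fun j =>
    if j ∈ J then a j % (N j - 1)
    else if a j = 0 then 0 else (a j - 1) % (N j - 1) + 1

/-- Schur (componentwise) product of two linear codes. -/
def schur {R F ι : Type} [Field F] [CommSemiring R] [Module R (ι → F)]
    (C D : Submodule R (ι → F)) : Submodule R (ι → F) :=
  Submodule.span R {w | ∃ u ∈ C, ∃ v ∈ D, w = u * v}

/-- Euclidean dual of a linear code over `F`. -/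
def dualCode (F : Type) [Field F] {n : Type} [Fintype n]
    (C : Submodule F (n → F)) : Submodule F (n → F) where
  carrier := {v | ∀ c ∈ C, ∑ i, v i * c i = 0}
  zero_mem' := by
    intro c hc
    simp
  add_mem' := by
    intro a b ha hb c hc
    simp [Pi.add_apply, add_mul, Finset.sum_add_distrib, ha c hc, hb c hc]
  smul_mem' := by
    intro r v hv c hc
    simp [Pi.smul_apply, smul_eq_mul, mul_assoc, ← Finset.mul_sum, hv c hc]

/-- The subfield subcode `S(C) = C ∩ K^n` of an `F`-linear code, as a `K`-linear code. -/
def subfieldSubcode (K : Type) {F n : Type} [Field K] [Field F] [Algebra K F]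
    (C : Submodule F (n → F)) : Submodule K (n → F) where
  carrier := {v | v ∈ C ∧ ∀ i, v i ∈ (algebraMap K F).range}
  zero_mem' := ⟨C.zero_mem, fun i => ⟨0, by simp⟩⟩
  add_mem' := by
    rintro a b ⟨haC, haS⟩ ⟨hbC, hbS⟩
    refine ⟨C.add_mem haC hbC, fun i => ?_⟩
    obtain ⟨x, hx⟩ := haS i
    obtain ⟨y, hy⟩ := hbS i
    exact ⟨x + y, by simp [hx, hy]⟩
  smul_mem' := by
    rintro r v ⟨hvC, hvS⟩
    constructor
    · have h := C.smul_mem (algebraMap K F r) hvC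
      rwa [algebraMap_smul] at h
    · intro i
      obtain ⟨x, hx⟩ := hvS i
      exact ⟨r * x, by simp [map_mul, hx, Pi.smul_apply, Algebra.smul_def]⟩

/-- The Euclidean dual, over the subfield `K`, of a `K`-linear code of length `n`
with entries in (the image of) `K`: vectors with entries in `K` orthogonal to all
codewords. -/
def dualK (K : Type) {F n : Type} [Field K] [Field F] [Algebra K F] [Fintype n]
    (C : Submodule K (n → F)) : Submodule K (n → F) where
  carrier := {v | (∀ i, v i ∈ (algebraMap K F).range) ∧ ∀ c ∈ C, ∑ i, v i * c i = 0}
  zero_mem' := ⟨fun i => ⟨0, by simp⟩, by intro c hc; simp⟩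
  add_mem' := by
    rintro a b ⟨haS, ha⟩ ⟨hbS, hb⟩
    constructor
    · intro i
      obtain ⟨x, hx⟩ := haS i
      obtain ⟨y, hy⟩ := hbS i
      exact ⟨x + y, by simp [hx, hy]⟩
    · intro c hc
      simp [Pi.add_apply, add_mul, Finset.sum_add_distrib, ha c hc, hb c hc]
  smul_mem' := by
    rintro r v ⟨hvS, hv⟩
    constructor
    · intro i
      obtain ⟨x, hx⟩ := hvS i
      exact ⟨r * x, by simp [map_mul, hx, Pi.smul_apply, Algebra.smul_def]⟩
    · intro c hc
      have hv' := hv c hc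
      simp only [Pi.smul_apply, Algebra.smul_def, mul_assoc]
      rw [← Finset.mul_sum, hv', mul_zero]

/-- The vectors all of whose entries lie in (the image of) the subfield `K`. -/
def fieldVectors (K : Type) (F n : Type) [Field K] [Field F] [Algebra K F] :
    Submodule K (n → F) where
  carrier := {v | ∀ i, v i ∈ (algebraMap K F).range}
  zero_mem' := fun i => ⟨0, by simp⟩
  add_mem' := by
    rintro a b haS hbS i
    obtain ⟨x, hx⟩ := haS i
    obtain ⟨y, hy⟩ := hbS i
    exact ⟨x + y, by simp [hx, hy]⟩
  smul_mem' := by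
    rintro r v hvS i
    obtain ⟨x, hx⟩ := hvS i
    exact ⟨r * x, by simp [map_mul, hx, Pi.smul_apply, Algebra.smul_def]⟩


/-- A pair `(C₁, C₂)` of binary (i.e. `K`-linear, with `K` the binary subfield)
codes is a CSS-T pair if `C₂ ⊆ C₁` and `C₂ ⊆ (C₁ ⋆ C₁)^⊥`. -/
def IsCSSTPair {K F n : Type} [Field K] [Field F] [Algebra K F] [Fintype n]
    (C1 C2 : Submodule K (n → F)) : Prop :=
  C2 ≤ C1 ∧ C2 ≤ dualK K (schur C1 C1)

open Polynomial in
theorem sum_nthRootsFinset_pow_eq_zero {F : Type} [Field F] {d b : ℕ} {ζ : F}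
    (hζ : IsPrimitiveRoot ζ d) (hd : 0 < d) (hb : ¬ d ∣ b) :
    ∑ x ∈ nthRootsFinset d (1 : F), x ^ b = 0 := by
  have hζ0 : ζ ≠ 0 := hζ.ne_zero hd.ne'
  have hshift : ∑ x ∈ nthRootsFinset d (1 : F), x ^ b =
      ∑ x ∈ nthRootsFinset d (1 : F), (ζ * x) ^ b := by
    symm
    refine Finset.sum_nbij' (fun x => ζ * x) (fun x => ζ⁻¹ * x) ?_ ?_ ?_ ?_ ?_
    · intro x hx
      rw [mem_nthRootsFinset hd] at hx ⊢
      rw [mul_pow, hx, hζ.pow_eq_one, one_mul]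
    · intro x hx
      rw [mem_nthRootsFinset hd] at hx ⊢
      rw [mul_pow, hx, inv_pow, hζ.pow_eq_one, inv_one, one_mul]
    · intro x _
      exact inv_mul_cancel_left₀ hζ0 x
    · intro x _
      exact mul_inv_cancel_left₀ hζ0 x
    · intro x _
      rfl
  simp only [mul_pow, ← Finset.mul_sum] at hshift
  by_contra hne
  exact hb ((hζ.pow_eq_one_iff_dvd b).1
    (mul_right_cancel₀ hne (hshift.symm.trans (one_mul _).symm)))

theorem FiniteField.exists_isPrimitiveRoot {F : Type} [Field F] [Fintype F] {d : ℕ}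
    (hd : d ∣ Fintype.card F - 1) : ∃ ζ : F, IsPrimitiveRoot ζ d := by
  obtain ⟨g, hg⟩ := IsCyclic.exists_ofOrder_eq_natCard (α := Fˣ)
  rw [Nat.card_eq_fintype_card, Fintype.card_units] at hg
  obtain ⟨e, he⟩ := hd
  have hpos : 0 < Fintype.card F - 1 := Nat.sub_pos_of_lt Fintype.one_lt_card
  have hprim : IsPrimitiveRoot (g : F) (Fintype.card F - 1) := by
    rw [← hg]
    exact (IsPrimitiveRoot.orderOf g).map_of_injective (f := Units.coeHom F) Units.val_injective
  exact ⟨_, hprim.pow hpos (he.trans (mul_comm d e))⟩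

open Polynomial in
/-- The roots in `F` of `X ^ N - X` are `0` and the roots of `X ^ (N - 1) - 1`. -/
theorem filter_pow_eq_self {F : Type} [Field F] [Fintype F] {N : ℕ} (hN : 1 < N) :
    Finset.univ.filter (fun x : F => x ^ N = x) = insert 0 (nthRootsFinset (N - 1) (1 : F)) := by
  ext x
  obtain ⟨d, rfl⟩ : ∃ d, N = d + 1 := ⟨N - 1, by omega⟩
  have hd : 0 < d := by omega
  simp only [Finset.mem_filter, Finset.mem_univ, true_and, Finset.mem_insert, Nat.add_sub_cancel,
    mem_nthRootsFinset hd, pow_succ]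
  rcases eq_or_ne x 0 with rfl | hx
  · simp
  · simp [hx]

/-- In characteristic two, the `b`-th power sum over the roots of `X ^ N - X` vanishes unless the
reduction of `b` into `{0, …, N - 1}` is `N - 1`. -/
theorem sum_roots_pow_eq_zero {F : Type} [Field F] [Fintype F] {N b : ℕ} (hN : 1 < N)
    (htwo : (2 : F) = 0) (hodd : Odd (N - 1)) (hdiv : N - 1 ∣ Fintype.card F - 1)
    (hb : (if b = 0 then 0 else (b - 1) % (N - 1) + 1) ≠ N - 1) :
    ∑ x ∈ Finset.univ.filter (fun x : F => x ^ N = x), x ^ b = 0 := by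
  obtain ⟨ζ, hζ⟩ := FiniteField.exists_isPrimitiveRoot hdiv
  have hd : 0 < N - 1 := by omega
  have h0 : (0 : F) ∉ Polynomial.nthRootsFinset (N - 1) (1 : F) := by
    simp [Polynomial.mem_nthRootsFinset hd, hd.ne']
  rw [filter_pow_eq_self hN, Finset.sum_insert h0]
  rcases Nat.eq_zero_or_pos b with rfl | hpos
  · obtain ⟨k, hk⟩ := hodd
    simp only [pow_zero, Finset.sum_const, nsmul_eq_mul, mul_one]
    rw [hζ.card_nthRootsFinset, hk]
    push_cast
    linear_combination (k + 1 : F) * htwo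
  · rw [zero_pow hpos.ne', zero_add]
    refine sum_nthRootsFinset_pow_eq_zero hζ hd ?_
    rintro ⟨e, rfl⟩
    apply hb
    obtain ⟨e, rfl⟩ : ∃ k, e = k + 1 := ⟨e - 1, by
      have := Nat.pos_of_mul_pos_left hpos
      omega⟩
    rw [if_neg hpos.ne', mul_add, mul_one, Nat.add_sub_assoc hd, Nat.mul_add_mod,
      Nat.mod_eq_of_lt (by omega)]
    omega

theorem sum_evJ {F : Type} [Field F] [Fintype F] (m : ℕ) (N : Fin m → ℕ) (J : Set (Fin m))
    (b : Fin m → ℕ) :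
    ∑ P, evJ F m N J b P = ∏ j, ∑ x ∈ Finset.univ.filter
      (fun x : F => if j ∈ J then x ^ (N j - 1) = 1 else x ^ N j = x), x ^ b j := by
  rw [Finset.prod_univ_sum]
  symm
  refine Finset.sum_subtype (p := (· ∈ ZJ F m N J)) _ (fun P => ?_)
    (fun P : Fin m → F => ∏ j, P j ^ b j)
  simp [ZJ]

theorem sum_evJ_eq_zero {F : Type} [Field F] [Fintype F] {m : ℕ} {N : Fin m → ℕ}
    {J : Set (Fin m)} (htwo : (2 : F) = 0) {j : Fin m} (hN : 1 < N j) (hodd : Odd (N j - 1))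
    (hdiv : N j - 1 ∣ Fintype.card F - 1) {b : Fin m → ℕ}
    (hb : (j ∈ J ∧ barJ m N J b j ≠ 0) ∨ (j ∉ J ∧ barJ m N J b j ≠ N j - 1)) :
    ∑ P, evJ F m N J b P = 0 := by
  rw [sum_evJ]
  refine Finset.prod_eq_zero (Finset.mem_univ j) ?_
  rcases hb with ⟨hj, hb⟩ | ⟨hj, hb⟩
  · obtain ⟨ζ, hζ⟩ := FiniteField.exists_isPrimitiveRoot hdiv
    have hd : 0 < N j - 1 := by omega
    simp only [barJ, if_pos hj] at hb ⊢
    rw [← sum_nthRootsFinset_pow_eq_zero hζ hd (b := b j) fun h => hb (Nat.mod_eq_zero_of_dvd h)]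
    refine Finset.sum_congr ?_ fun _ _ => rfl
    ext x
    simp [Polynomial.mem_nthRootsFinset hd]
  · simp only [barJ, if_neg hj] at hb ⊢
    exact sum_roots_pow_eq_zero hN htwo hodd hdiv hb

theorem evJ_add {F : Type} [Field F] {m : ℕ} {N : Fin m → ℕ} {J : Set (Fin m)}
    (a b : Fin m → ℕ) : evJ F m N J (a + b) = evJ F m N J a * evJ F m N J b := by
  ext P
  simp [evJ, pow_add, Finset.prod_mul_distrib]

theorem CJ_mono {F : Type} [Field F] {m : ℕ} {N : Fin m → ℕ} {J : Set (Fin m)}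
    {Δ Δ' : Set (Fin m → ℕ)} (h : Δ ⊆ Δ') : CJ F m N J Δ ≤ CJ F m N J Δ' :=
  Submodule.span_mono (Set.image_mono h)

theorem mul_mem_CJ_add {F : Type} [Field F] {m : ℕ} {N : Fin m → ℕ} {J : Set (Fin m)}
    {A B : Set (Fin m → ℕ)} {u v : ZJ F m N J → F} (hu : u ∈ CJ F m N J A)
    (hv : v ∈ CJ F m N J B) : u * v ∈ CJ F m N J (A + B) := by
  have h := Submodule.mul_mem_mul hu hv
  rw [CJ, CJ, Submodule.span_mul_span] at h
  refine Submodule.span_mono ?_ h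
  rintro _ ⟨_, ⟨a, ha, rfl⟩, _, ⟨b, hb, rfl⟩, rfl⟩
  exact ⟨a + b, Set.add_mem_add ha hb, evJ_add a b⟩

theorem sum_eq_zero_of_mem_CJ {F : Type} [Field F] [Fintype F] {m : ℕ} {N : Fin m → ℕ}
    {J : Set (Fin m)} {A : Set (Fin m → ℕ)} (hA : ∀ a ∈ A, ∑ P, evJ F m N J a P = 0)
    {u : ZJ F m N J → F} (hu : u ∈ CJ F m N J A) : ∑ P, u P = 0 := by
  induction hu using Submodule.span_induction with
  | mem _ h =>
    obtain ⟨a, ha, rfl⟩ := h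
    exact hA a ha
  | zero => simp
  | add _ _ _ _ hx hy => simp [Finset.sum_add_distrib, hx, hy]
  | smul _ _ _ hx => simp [← Finset.mul_sum, hx]

/-- with `q = 2^r` and `Δ₁, Δ₂ ⊆ E_J` unions of complete cyclotomic
sets with respect to `F₂`, if `Δ₂ ⊆ Δ₁` and for every
`a ∈ bar (Δ₁ + Δ₁ + Δ₂)` there is `j` with (`j ∈ J` and `a_j ≠ 0`) or
(`j ∉ J` and `a_j ≠ N_j − 1`), then `(S(C^J_{Δ₁}), S(C^J_{Δ₂}))` is a CSS-T pair. -/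
theorem cssT_pair_of_conditions
    {F K : Type} [Field F] [Fintype F] [Field K] [Fintype K] [Algebra K F]
    (r : ℕ) (hr : 1 ≤ r) (hF : Fintype.card F = 2 ^ r) (hK : Fintype.card K = 2)
    (m : ℕ) (hm : 1 ≤ m)
    (N : Fin m → ℕ) (hN : ∀ j, 1 < N j)
    (hdiv : ∀ j, (N j - 1) ∣ (Fintype.card F - 1))
    (J : Set (Fin m)) (Δ1 Δ2 : Set (Fin m → ℕ))
    (hΔ1 : Δ1 ⊆ EJ m N J) (hΔ2 : Δ2 ⊆ EJ m N J)
    (hc1 : ∀ a ∈ Δ1, barJ m N J (fun j => 2 * a j) ∈ Δ1)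
    (hc2 : ∀ a ∈ Δ2, barJ m N J (fun j => 2 * a j) ∈ Δ2)
    (hsub : Δ2 ⊆ Δ1)
    (hcond : ∀ a ∈ barJ m N J '' (Δ1 + Δ1 + Δ2),
      ∃ j, (j ∈ J ∧ a j ≠ 0) ∨ (j ∉ J ∧ a j ≠ N j - 1)) :
    IsCSSTPair (subfieldSubcode K (CJ F m N J Δ1)) (subfieldSubcode K (CJ F m N J Δ2)) := by
  have hchar : CharP F 2 := by
    obtain ⟨p, hp⟩ := CharP.exists F
    obtain ⟨n, hprime, hcard⟩ := FiniteField.card F p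
    have hdvd : p ∣ 2 := hprime.dvd_of_dvd_pow
      (hF ▸ hcard ▸ dvd_pow_self p n.ne_zero : p ∣ 2 ^ r)
    rwa [(Nat.prime_dvd_prime_iff_eq hprime Nat.prime_two).1 hdvd] at hp
  have htwo : (2 : F) = 0 := CharTwo.two_eq_zero
  have hodd : ∀ j, Odd (N j - 1) := fun j => by
    refine Odd.of_dvd_nat ?_ (hdiv j)
    rw [hF]
    exact Nat.Even.sub_odd Nat.one_le_two_pow (even_two.pow_of_ne_zero (by omega)) odd_one
  have hsum : ∀ b ∈ Δ1 + Δ1 + Δ2, ∑ P, evJ F m N J b P = 0 := fun b hb => by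
    obtain ⟨j, hj⟩ := hcond _ ⟨b, hb, rfl⟩
    exact sum_evJ_eq_zero htwo (hN j) (hodd j) (hdiv j) hj
  refine ⟨fun v hv => ⟨CJ_mono hsub hv.1, hv.2⟩, fun v hv => ⟨hv.2, fun c hc => ?_⟩⟩
  induction hc using Submodule.span_induction with
  | mem _ h =>
    obtain ⟨u, hu, w, hw, rfl⟩ := h
    rw [← sum_eq_zero_of_mem_CJ hsum (mul_mem_CJ_add (mul_mem_CJ_add hu.1 hw.1) hv.1)]
    exact Finset.sum_congr rfl fun P _ => mul_comm _ _
  | zero => simp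
  | add _ _ _ _ hx hy => simp [mul_add, Finset.sum_add_distrib, hx, hy]
  | smul _ _ _ hx => simp [← Finset.smul_sum, hx]

end
end

section
/- Let q be a power of the prime p, m ≥ 1, N_j > 1 with N_j − 1 dividing q − 1 for j = 1,…,m, and J ⊆ {1,…,m}, and assume p divides N_j for every j ∉ J. Let Δ ⊆ E' := {0,…,N_1−2} × ⋯ × {0,…,N_m−2} and define Δ^⊥ = E_J \ { \overline{(N_1 − 1 − a_1, …, N_m − 1 − a_m)} : a ∈ Δ }. Then (C^J_Δ)^⊥ = C^J_{Δ^⊥}. -/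
attribute [local instance] Classical.propDecidable

open scoped Pointwise

noncomputable section

theorem Nat.dvd_iff_eq_of_lt_two_mul {n k : ℕ} (hk : 0 < k) (hlt : k < 2 * n) :
    n ∣ k ↔ k = n := by
  refine ⟨?_, fun h => h ▸ dvd_rfl⟩
  rintro ⟨c, rfl⟩
  have h1 : 0 < c := Nat.pos_of_mul_pos_left hk
  have h2 : c < 2 := Nat.lt_of_mul_lt_mul_left (a := n) (by rwa [mul_comm n 2])
  rw [show c = 1 by omega, mul_one]

open Polynomial in
/-- The sum of the `k`-th powers of the `n`-th roots of unity, given a primitive one. -/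
theorem IsPrimitiveRoot.sum_pow_nthRootsFinset {F : Type*} [Field F] {n : ℕ} {ζ : F}
    (hζ : IsPrimitiveRoot ζ n) (hn : 0 < n) (k : ℕ) :
    ∑ x ∈ nthRootsFinset n (1 : F), x ^ k = if n ∣ k then (n : F) else 0 := by
  split_ifs with h
  · rw [Finset.sum_congr rfl (g := fun _ => 1), Finset.sum_const, hζ.card_nthRootsFinset,
      nsmul_one]
    intro x hx
    obtain ⟨c, rfl⟩ := h
    rw [pow_mul, (Polynomial.mem_nthRootsFinset hn 1).1 hx, one_pow]
  · have hζ0 : ζ ≠ 0 := hζ.ne_zero hn.ne'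
    have key : ∑ x ∈ nthRootsFinset n (1 : F), x ^ k =
        ζ ^ k * ∑ x ∈ nthRootsFinset n (1 : F), x ^ k := by
      rw [Finset.mul_sum]
      refine Finset.sum_bij' (fun x _ => ζ⁻¹ * x) (fun x _ => ζ * x) ?_ ?_ ?_ ?_ ?_
      · intro x hx
        rw [Polynomial.mem_nthRootsFinset hn] at hx ⊢
        rw [mul_pow, inv_pow, hζ.pow_eq_one, hx, inv_one, one_mul]
      · intro x hx
        rw [Polynomial.mem_nthRootsFinset hn] at hx ⊢
        rw [mul_pow, hζ.pow_eq_one, hx, one_mul]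
      · intro x _
        exact mul_inv_cancel_left₀ hζ0 x
      · intro x _
        exact inv_mul_cancel_left₀ hζ0 x
      · intro x _
        rw [← mul_pow, mul_inv_cancel_left₀ hζ0]
    have hne : ζ ^ k ≠ 1 := fun h' => h (hζ.dvd_of_pow_eq_one k h')
    by_contra hS
    exact hne (mul_right_cancel₀ hS (by rw [← key, one_mul]))

theorem FiniteField.exists_isPrimitiveRoot_of_dvd (F : Type*) [Field F] [Fintype F] {n : ℕ}
    (hdvd : n ∣ Fintype.card F - 1) : ∃ ζ : F, IsPrimitiveRoot ζ n := by
  obtain ⟨g, hg⟩ := IsCyclic.exists_generator (α := Fˣ)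
  have hord : orderOf g = Fintype.card F - 1 := by
    rw [orderOf_eq_card_of_forall_mem_zpowers hg, Nat.card_eq_fintype_card, Fintype.card_units]
  obtain ⟨c, hc⟩ := hdvd
  have hpos : 0 < Fintype.card F - 1 := by
    have := Fintype.one_lt_card (α := F)
    omega
  have hprim : IsPrimitiveRoot g (Fintype.card F - 1) := hord ▸ IsPrimitiveRoot.orderOf g
  have h := hprim.pow hpos (hc.trans (mul_comm _ _))
  exact ⟨_, IsPrimitiveRoot.coe_units_iff.2 h⟩

theorem FiniteField.natCast_ne_zero_of_dvd {F : Type*} [Field F] [Fintype F] {n : ℕ}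
    (hdvd : n ∣ Fintype.card F - 1) : (n : F) ≠ 0 := by
  intro h
  obtain ⟨c, hc⟩ := hdvd
  have h1 : ((Fintype.card F : ℕ) : F) = n * c + 1 := by
    rw [← Nat.cast_mul, ← hc, ← Nat.cast_add_one, Nat.sub_add_cancel Fintype.card_pos]
  simp [h] at h1

open Polynomial in
theorem FiniteField.sum_pow_nthRootsFinset_ne_zero_iff {F : Type*} [Field F] [Fintype F] {n : ℕ}
    (hn : 0 < n) (hdvd : n ∣ Fintype.card F - 1) (k : ℕ) :
    ∑ x ∈ nthRootsFinset n (1 : F), x ^ k ≠ 0 ↔ n ∣ k := by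
  obtain ⟨ζ, hζ⟩ := FiniteField.exists_isPrimitiveRoot_of_dvd F hdvd
  rw [hζ.sum_pow_nthRootsFinset hn]
  simp [FiniteField.natCast_ne_zero_of_dvd hdvd]

open Polynomial in
/-- The projection `Z_j` of the evaluation set to the `j`-th coordinate. -/
def coordZ (F : Type) [Field F] {m : ℕ} (N : Fin m → ℕ) (J : Set (Fin m)) (j : Fin m) :
    Finset F :=
  if j ∈ J then nthRootsFinset (N j - 1) 1 else insert 0 (nthRootsFinset (N j - 1) 1)

section

variable {F : Type} [Field F] {m : ℕ} {N : Fin m → ℕ} {J : Set (Fin m)}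

theorem mem_coordZ_iff {j : Fin m} (hN : 1 < N j) (x : F) :
    x ∈ coordZ F N J j ↔ if j ∈ J then x ^ (N j - 1) = 1 else x ^ N j = x := by
  have hpos : 0 < N j - 1 := by omega
  unfold coordZ
  split_ifs with h
  · exact Polynomial.mem_nthRootsFinset hpos 1
  · rw [Finset.mem_insert, Polynomial.mem_nthRootsFinset hpos 1]
    conv_rhs => rw [show N j = N j - 1 + 1 by omega, pow_succ]
    by_cases hx : x = 0 <;> simp [hx]

theorem mem_ZJ_iff (hN : ∀ j, 1 < N j) (P : Fin m → F) :
    P ∈ ZJ F m N J ↔ ∀ j, P j ∈ coordZ F N J j :=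
  forall_congr' fun j => (mem_coordZ_iff (hN j) (P j)).symm

theorem card_coordZ_le {j : Fin m} (hN : 1 < N j) :
    (coordZ F N J j).card ≤ (if j ∈ J then N j - 2 else N j - 1) + 1 := by
  have h : (Polynomial.nthRootsFinset (N j - 1) (1 : F)).card ≤ N j - 1 := by
    rw [Polynomial.nthRootsFinset_def]
    exact (Multiset.toFinset_card_le _).trans (Polynomial.card_nthRoots _ _)
  unfold coordZ
  split_ifs
  · omega
  · exact (Finset.card_insert_le _ _).trans (by omega)

theorem sum_ZJ_prod [Fintype F] (hN : ∀ j, 1 < N j) (f : Fin m → F → F) :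
    ∑ P : ZJ F m N J, ∏ j, f j ((P : Fin m → F) j) = ∏ j, ∑ x ∈ coordZ F N J j, f j x := by
  rw [Finset.prod_univ_sum]
  refine (Finset.sum_subtype _ (fun P => ?_) (fun P : Fin m → F => ∏ j, f j (P j))).symm
  rw [Fintype.mem_piFinset, mem_ZJ_iff hN]

theorem sum_pow_coordZ_ne_zero_iff [Fintype F] (p : ℕ) [CharP F p] {j : Fin m} (hN : 1 < N j)
    (hdiv : (N j - 1) ∣ (Fintype.card F - 1)) (hpN : j ∉ J → p ∣ N j)
    {a b : ℕ} (ha : a ≤ N j - 2) (hb : b ≤ if j ∈ J then N j - 2 else N j - 1) :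
    ∑ x ∈ coordZ F N J j, x ^ (b + a) ≠ 0 ↔
      b = if j ∈ J then (N j - 1 - a) % (N j - 1)
        else if N j - 1 - a = 0 then 0 else (N j - 1 - a - 1) % (N j - 1) + 1 := by
  have hpos : 0 < N j - 1 := by omega
  have key := FiniteField.sum_pow_nthRootsFinset_ne_zero_iff (F := F) hpos hdiv (b + a)
  unfold coordZ
  split_ifs at hb ⊢ with hJ h0
  · rw [key]
    rcases Nat.eq_zero_or_pos a with rfl | ha0
    · rw [Nat.sub_zero, Nat.mod_self, add_zero]
      exact ⟨fun h => Nat.eq_zero_of_dvd_of_lt h (by omega), fun h => h ▸ dvd_zero _⟩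
    · rw [Nat.mod_eq_of_lt (by omega)]
      rw [Nat.dvd_iff_eq_of_lt_two_mul (by omega) (by omega)]
      omega
  · omega
  · rw [Nat.mod_eq_of_lt (by omega), Finset.sum_insert (by
      rw [Polynomial.mem_nthRootsFinset hpos, zero_pow hpos.ne']; exact zero_ne_one)]
    rcases Nat.eq_zero_or_pos (b + a) with hz | hz
    · have hNF : ((N j : ℕ) : F) = 0 := (CharP.cast_eq_zero_iff F p _).2 (hpN hJ)
      obtain ⟨ζ, hζ⟩ := FiniteField.exists_isPrimitiveRoot_of_dvd F hdiv
      rw [hζ.sum_pow_nthRootsFinset hpos, hz, if_pos (dvd_zero _), pow_zero, add_comm,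
        ← Nat.cast_add_one, Nat.sub_add_cancel hN.le, hNF]
      simp only [ne_eq, not_true_eq_false, false_iff]
      omega
    · rw [zero_pow hz.ne', zero_add, key, Nat.dvd_iff_eq_of_lt_two_mul hz (by omega)]
      omega

theorem sum_evJ_mul_evJ_ne_zero_iff [Fintype F] (p : ℕ) [CharP F p] (hN : ∀ j, 1 < N j)
    (hdiv : ∀ j, (N j - 1) ∣ (Fintype.card F - 1)) (hpN : ∀ j, j ∉ J → p ∣ N j)
    {a b : Fin m → ℕ} (ha : ∀ j, a j ≤ N j - 2) (hb : b ∈ EJ m N J) :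
    ∑ P, evJ F m N J b P * evJ F m N J a P ≠ 0 ↔ b = barJ m N J (fun j => N j - 1 - a j) := by
  have h : ∑ P, evJ F m N J b P * evJ F m N J a P =
      ∏ j, ∑ x ∈ coordZ F N J j, x ^ (b j + a j) := by
    rw [← sum_ZJ_prod hN]
    refine Finset.sum_congr rfl fun P _ => ?_
    simp only [evJ, ← Finset.prod_mul_distrib, pow_add]
  rw [h, Finset.prod_ne_zero_iff, funext_iff]
  simp only [Finset.mem_univ, true_imp_iff]
  exact forall_congr' fun j =>
    sum_pow_coordZ_ne_zero_iff p (hN j) (hdiv j) (hpN j) (ha j) (hb j)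

theorem single_mem_CJ_EJ [Fintype F] (hN : ∀ j, 1 < N j) (P : ZJ F m N J) :
    (Pi.single P 1 : ZJ F m N J → F) ∈ CJ F m N J (EJ m N J) := by
  have hP := (mem_ZJ_iff hN _).1 P.2
  let l : Fin m → Polynomial F := fun j => Lagrange.basis (coordZ F N J j) id (P.1 j)
  let T : Fin m → ℕ := fun j => if j ∈ J then N j - 2 else N j - 1
  have hdeg : ∀ j, (l j).natDegree < T j + 1 := by
    intro j
    have hc : 0 < (coordZ F N J j).card := Finset.card_pos.2 ⟨_, hP j⟩
    have hle : (coordZ F N J j).card ≤ T j + 1 := card_coordZ_le (hN j)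
    rw [Lagrange.natDegree_basis Function.injective_id.injOn (hP j)]
    omega
  have hsingle : (Pi.single P 1 : ZJ F m N J → F) =
      ∑ b ∈ Fintype.piFinset fun j => Finset.range (T j + 1),
        (∏ j, (l j).coeff (b j)) • evJ F m N J b := by
    funext Q
    have hQ := (mem_ZJ_iff hN _).1 Q.2
    have heval : ∏ j, (l j).eval (Q.1 j) = if Q = P then 1 else 0 := by
      split_ifs with h
      · subst h
        exact Finset.prod_eq_one fun j _ =>
          Lagrange.eval_basis_self Function.injective_id.injOn (hP j)
      · obtain ⟨j, hj⟩ := Function.ne_iff.1 fun h' => h (Subtype.ext h')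
        exact Finset.prod_eq_zero (Finset.mem_univ j)
          (Lagrange.eval_basis_of_ne (v := id) (Ne.symm hj) (hQ j))
    rw [Pi.single_apply, ← heval,
      Finset.prod_congr rfl fun j _ => Polynomial.eval_eq_sum_range' (hdeg j) (Q.1 j),
      Finset.prod_univ_sum, Finset.sum_apply]
    refine Finset.sum_congr rfl fun b _ => ?_
    rw [Pi.smul_apply, smul_eq_mul, evJ, Finset.prod_mul_distrib]
  rw [hsingle]
  refine Submodule.sum_mem _ fun b hb => Submodule.smul_mem _ _ (Submodule.subset_span ⟨b, ?_, rfl⟩)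
  intro j
  exact Nat.lt_succ_iff.1 (Finset.mem_range.1 (Fintype.mem_piFinset.1 hb j))

theorem CJ_EJ_eq_top [Fintype F] (hN : ∀ j, 1 < N j) : CJ F m N J (EJ m N J) = ⊤ := by
  refine eq_top_iff.2 fun v _ => ?_
  rw [pi_eq_sum_univ' v]
  refine Submodule.sum_mem _ fun P _ => Submodule.smul_mem _ _ ?_
  convert single_mem_CJ_EJ hN P using 1

theorem mem_dualCode_CJ_iff [Fintype F] (Δ : Set (Fin m → ℕ)) (v : ZJ F m N J → F) :
    v ∈ dualCode F (CJ F m N J Δ) ↔ ∀ a ∈ Δ, ∑ P, v P * evJ F m N J a P = 0 := by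
  refine ⟨fun h a ha => h _ (Submodule.subset_span ⟨a, ha, rfl⟩), fun h c hc => ?_⟩
  induction hc using Submodule.span_induction with
  | mem c hc =>
    obtain ⟨a, ha, rfl⟩ := hc
    exact h a ha
  | zero => simp
  | add c d _ _ hc hd => simp [mul_add, Finset.sum_add_distrib, hc, hd]
  | smul r c _ hc => simp [mul_left_comm _ r, ← Finset.mul_sum, hc]

end

/-- if `p ∣ N_j` for every `j ∉ J` and `Δ ⊆ E' = ∏_j {0,…,N_j-2}`,
then the Euclidean dual of `C^J_Δ` is `C^J_{Δ^⊥}` where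
`Δ^⊥ = E_J \ { bar (N - 1 - a) : a ∈ Δ }`. -/
theorem dual_CJ_eq
    {F : Type} [Field F] [Fintype F] (p : ℕ) [Fact p.Prime] [CharP F p]
    (m : ℕ) (hm : 1 ≤ m)
    (N : Fin m → ℕ) (hN : ∀ j, 1 < N j)
    (hdiv : ∀ j, (N j - 1) ∣ (Fintype.card F - 1))
    (J : Set (Fin m)) (hpN : ∀ j, j ∉ J → p ∣ N j)
    (Δ : Set (Fin m → ℕ)) (hΔ : Δ ⊆ {a | ∀ j, a j ≤ N j - 2}) :
    dualCode F (CJ F m N J Δ) =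
      CJ F m N J
        (EJ m N J \ ((fun a => barJ m N J (fun j => N j - 1 - a j)) '' Δ)) := by
  apply le_antisymm
  · intro v hv
    rw [mem_dualCode_CJ_iff] at hv
    have hvE : v ∈ CJ F m N J (EJ m N J) := by rw [CJ_EJ_eq_top hN]; trivial
    obtain ⟨l, hl, rfl⟩ := (Finsupp.mem_span_image_iff_linearCombination F).1 hvE
    refine (Finsupp.mem_span_image_iff_linearCombination F).2 ⟨l, ?_, rfl⟩
    rw [Finsupp.mem_supported] at hl ⊢
    refine fun b hb => ⟨hl hb, ?_⟩
    rintro ⟨a, ha, rfl⟩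
    have h := hv a ha
    simp only [Finsupp.linearCombination_apply, Finsupp.sum, Finset.sum_apply, Pi.smul_apply,
      smul_eq_mul, Finset.sum_mul, mul_assoc] at h
    rw [Finset.sum_comm] at h
    simp only [← Finset.mul_sum] at h
    rw [Finset.sum_eq_single_of_mem _ hb] at h
    · exact mul_ne_zero (Finsupp.mem_support_iff.1 hb)
        ((sum_evJ_mul_evJ_ne_zero_iff p hN hdiv hpN (hΔ ha) (hl hb)).2 rfl) h
    · intro c hc hne
      rw [mul_eq_zero]
      right
      by_contra h0
      exact hne ((sum_evJ_mul_evJ_ne_zero_iff p hN hdiv hpN (hΔ ha) (hl hc)).1 h0)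
  · refine Submodule.span_le.2 ?_
    rintro _ ⟨b, ⟨hbE, hb⟩, rfl⟩
    rw [SetLike.mem_coe, mem_dualCode_CJ_iff]
    intro a ha
    by_contra h
    exact hb ⟨a, ha, ((sum_evJ_mul_evJ_ne_zero_iff p hN hdiv hpN (hΔ ha) hbE).1 h).symm⟩

end
end
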